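/- Suppose A ∈ ℝ^{n×n} is symmetric and B = A (so C = A²). For fixed u, v ∈ [n], define the modified single-sample estimator on quadruples (k',i,k,j) by Z'_{uv}(k',i,k,j) = (1/2)·sgn(a_{ki}·a_{kj}·a_{k'i})·a_{k'j}·( 1[(i,j) = (u,v)] + 1[(k,k') = (u,v)] ). Then the expectation of Z'_{uv} under the diamond-sampling distribution equals c_{uv}² / ‖W‖₁, where c_{uv} = (A²)_{uv} = ∑_k a_{uk}·a_{kv}. -/

import Mathlib

open Finset

/-- `sgn x = 1` if `x ≥ 0` and `-1` otherwise. -/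
noncomputable def sgn (x : ℝ) : ℝ := if 0 ≤ x then 1 else -1

theorem abs_mul_sgn (x : ℝ) : |x| * sgn x = x := by
  unfold sgn
  split_ifs with h
  · rw [abs_of_nonneg h, mul_one]
  · rw [abs_of_neg (not_le.mp h)]
    ring

theorem sum_abs_ne_zero {ι : Type*} [Fintype ι] {f : ι → ℝ} (h : ∃ i, f i ≠ 0) :
    ∑ i, |f i| ≠ 0 := by
  obtain ⟨i, hi⟩ := h
  exact (Finset.sum_pos' (fun _ _ => abs_nonneg _) ⟨i, Finset.mem_univ i, abs_pos.mpr hi⟩).ne'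

/-- For a symmetric matrix `A` with `B = A` (so `C = A²`), the modified
single-sample estimator `Z'_{uv}` (which credits both the pair `(i,j)` and the
pair `(k,k')`, each with weight `1/2`) has expectation `c_{uv}² / ‖W‖₁` under
the diamond-sampling distribution. -/
theorem symmetric_square_diamond_expectation
    (n : ℕ) (hn : 0 < n)
    (A : Matrix (Fin n) (Fin n) ℝ)
    (hsym : ∀ k i, A k i = A i k)
    (W1 : ℝ)
    (hW1 : W1 = ∑ k : Fin n, ∑ i : Fin n,
        |A k i| * (∑ k' : Fin n, |A k' i|) * (∑ j : Fin n, |A k j|))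
    (hW1pos : 0 < W1)
    (hArow : ∀ k : Fin n, ∃ j : Fin n, A k j ≠ 0)
    (p : Fin n × Fin n × Fin n × Fin n → ℝ)
    (hp : ∀ (l' : Fin n) (i0 : Fin n) (l : Fin n) (j0 : Fin n),
        p (l', i0, l, j0)
          = ((|A l i0| * (∑ k'' : Fin n, |A k'' i0|) * (∑ j' : Fin n, |A l j'|)) / W1)
            * (|A l j0| / (∑ j' : Fin n, |A l j'|))
            * (|A l' i0| / (∑ k'' : Fin n, |A k'' i0|)))
    (u v : Fin n)
    (Z : Fin n × Fin n × Fin n × Fin n → ℝ)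
    (hZ : ∀ (k' i k j : Fin n),
        Z (k', i, k, j)
          = (1 / 2) * sgn (A k i * A k j * A k' i) * A k' j
            * ((if i = u ∧ j = v then (1 : ℝ) else 0)
              + (if k = u ∧ k' = v then (1 : ℝ) else 0))) :
    ∑ q : Fin n × Fin n × Fin n × Fin n, p q * Z q
      = (∑ k : Fin n, A u k * A k v) ^ 2 / W1 := by
  have hterm : ∀ k' i k j, p (k', i, k, j) * Z (k', i, k, j)
      = (if i = u then if j = v then A k i * A k j * A k' i * A k' j / W1 / 2 else 0 else 0)
        + (if k = u then if k' = v then A k i * A k j * A k' i * A k' j / W1 / 2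
            else 0 else 0) := by
    intro k' i k j
    have hrow : ∑ j', |A k j'| ≠ 0 := sum_abs_ne_zero (hArow k)
    have hcol : ∑ k'', |A k'' i| ≠ 0 := by
      simp only [hsym _ i]
      exact sum_abs_ne_zero (hArow i)
    have hpZ : p (k', i, k, j) * Z (k', i, k, j)
        = (|A k i * A k j * A k' i| * sgn (A k i * A k j * A k' i)) * A k' j / W1 / 2
          * ((if i = u ∧ j = v then (1 : ℝ) else 0)
            + (if k = u ∧ k' = v then (1 : ℝ) else 0)) := by
      rw [hp, hZ, abs_mul, abs_mul]
      field_simp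
    rw [hpZ, abs_mul_sgn, mul_add, ite_and, ite_and]
    simp only [mul_ite, mul_one, mul_zero]
  have hrow_pair : ∑ k', ∑ k, A k u * A k v * A k' u * A k' v / W1 / 2
      = (∑ k, A u k * A k v) ^ 2 / W1 / 2 := by
    rw [sq, Finset.sum_mul_sum, Finset.sum_div, Finset.sum_div]
    refine Finset.sum_congr rfl fun k' _ => ?_
    rw [Finset.sum_div, Finset.sum_div]
    refine Finset.sum_congr rfl fun k _ => ?_
    rw [hsym u k, hsym u k']
    ring
  have hcol_pair : ∑ i, ∑ j, A u i * A u j * A v i * A v j / W1 / 2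
      = (∑ k, A u k * A k v) ^ 2 / W1 / 2 := by
    rw [sq, Finset.sum_mul_sum, Finset.sum_div, Finset.sum_div]
    refine Finset.sum_congr rfl fun i _ => ?_
    rw [Finset.sum_div, Finset.sum_div]
    refine Finset.sum_congr rfl fun j _ => ?_
    rw [hsym v i, hsym v j]
    ring
  simp only [Fintype.sum_prod_type, hterm, Finset.sum_add_distrib]
  simp only [Finset.sum_ite_irrel, Finset.sum_const_zero, Finset.sum_ite_eq', Finset.mem_univ,
    if_true]
  rw [hrow_pair, hcol_pair]
  ring
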